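/- Let R be a ring and let D denote the class of all flat Mittag-Leffler right R-modules. Given any countable chain of R-module homomorphisms F_0 → F_1 → F_2 → ⋯ such that every F_n is flat and Mittag-Leffler, the direct limit F = colim_{n<ω} F_n satisfies Ext^1_R(F, C) = 0 for every module C with Ext^1_R(D, C) = 0 for all D ∈ D; that is, F belongs to the double orthogonal class ^⊥(D^⊥). -/

import Mathlib

/-! Tensor product of a right `R`-module with a left `R`-module over a
(possibly noncommutative) ring `R`, Mittag-Leffler modules, flat right modules. -/

universe u

open scoped TensorProduct DirectSum

section NCTensor

variable (R : Type u) [Ring R] (M : Type u) [AddCommGroup M] [Module Rᵐᵒᵖ M]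

/-- The subgroup of balancing relations in `M ⊗_ℤ Q`, where `M` is a right `R`-module
and `Q` is a left `R`-module. -/
noncomputable def balancedSub (Q : Type u) [AddCommGroup Q] [Module R Q] :
    AddSubgroup (TensorProduct ℤ M Q) :=
  AddSubgroup.closure
    {x | ∃ (m : M) (r : R) (q : Q),
      x = (MulOpposite.op r • m) ⊗ₜ[ℤ] q - m ⊗ₜ[ℤ] (r • q)}

/-- The tensor product `M ⊗_R Q` of a right `R`-module `M` and a left `R`-module `Q`. -/
def NCTensor (Q : Type u) [AddCommGroup Q] [Module R Q] : Type u :=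
  TensorProduct ℤ M Q ⧸ balancedSub R M Q

noncomputable instance (Q : Type u) [AddCommGroup Q] [Module R Q] : AddCommGroup (NCTensor R M Q) :=
  inferInstanceAs (AddCommGroup (TensorProduct ℤ M Q ⧸ balancedSub R M Q))

/-- The canonical projection onto the tensor product `M ⊗_R Q`. -/
noncomputable def NCTensor.mk (Q : Type u) [AddCommGroup Q] [Module R Q] :
    TensorProduct ℤ M Q →+ NCTensor R M Q :=
  QuotientAddGroup.mk' (balancedSub R M Q)

variable {R M} in
/-- The map `M ⊗_R Q →+ M ⊗_R Q'` induced by a map of left `R`-modules `f : Q → Q'`. -/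
noncomputable def NCTensor.map {Q Q' : Type u} [AddCommGroup Q] [Module R Q]
    [AddCommGroup Q'] [Module R Q'] (f : Q →ₗ[R] Q') :
    NCTensor R M Q →+ NCTensor R M Q' :=
  QuotientAddGroup.lift (balancedSub R M Q)
    ((NCTensor.mk R M Q').comp
      (LinearMap.lTensor M f.toAddMonoidHom.toIntLinearMap).toAddMonoidHom)
    (by
      set φ := (NCTensor.mk R M Q').comp
        (LinearMap.lTensor M f.toAddMonoidHom.toIntLinearMap).toAddMonoidHom with hφ
      intro x hx
      have hle : balancedSub R M Q ≤ φ.ker := by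
        rw [balancedSub]
        rw [AddSubgroup.closure_le]
        rintro _ ⟨m, r, q, rfl⟩
        have h1 : φ ((MulOpposite.op r • m) ⊗ₜ[ℤ] q - m ⊗ₜ[ℤ] (r • q)) =
            NCTensor.mk R M Q'
              ((MulOpposite.op r • m) ⊗ₜ[ℤ] (f q) - m ⊗ₜ[ℤ] (r • f q)) := by
          simp [hφ, LinearMap.lTensor_tmul, map_sub]
        simp only [SetLike.mem_coe, AddMonoidHom.mem_ker, h1]
        exact (QuotientAddGroup.eq_zero_iff _).2
          (AddSubgroup.subset_closure ⟨m, r, f q, rfl⟩)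
      exact hle hx)

variable {ι : Type u} (Q : ι → Type u) [∀ i, AddCommGroup (Q i)] [∀ i, Module R (Q i)]

/-- Auxiliary map for the Mittag-Leffler comparison map. -/
noncomputable def piCompareAux :
    TensorProduct ℤ M (∀ i, Q i) →+ ∀ i, NCTensor R M (Q i) where
  toFun x i := NCTensor.mk R M (Q i)
    (LinearMap.lTensor M (LinearMap.proj (R := ℤ) (φ := Q) i) x)
  map_zero' := by funext i; simp
  map_add' x y := by funext i; simp [map_add]

/-- The canonical comparison map `M ⊗_R (∏ i, Q i) →+ ∏ i, (M ⊗_R Q i)`. -/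
noncomputable def mlCompare : NCTensor R M (∀ i, Q i) →+ ∀ i, NCTensor R M (Q i) :=
  QuotientAddGroup.lift (balancedSub R M (∀ i, Q i)) (piCompareAux R M Q)
    (by
      intro x hx
      have hle : balancedSub R M (∀ i, Q i) ≤ (piCompareAux R M Q).ker := by
        rw [balancedSub, AddSubgroup.closure_le]
        rintro _ ⟨m, r, q, rfl⟩
        simp only [SetLike.mem_coe, AddMonoidHom.mem_ker]
        funext i
        have h1 : piCompareAux R M Q
            ((MulOpposite.op r • m) ⊗ₜ[ℤ] q - m ⊗ₜ[ℤ] (r • q)) i =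
            NCTensor.mk R M (Q i)
              ((MulOpposite.op r • m) ⊗ₜ[ℤ] (q i) - m ⊗ₜ[ℤ] (r • q i)) := by
          simp [piCompareAux, map_sub, LinearMap.lTensor_tmul]
        rw [Pi.zero_apply, h1]
        exact (QuotientAddGroup.eq_zero_iff _).2
          (AddSubgroup.subset_closure ⟨m, r, q i, rfl⟩)
      exact hle hx)

/-- A right `R`-module `M` is Mittag-Leffler if for every family `(Q i)` of left
`R`-modules the canonical map `M ⊗_R ∏ Q i → ∏ (M ⊗_R Q i)` is injective. -/
def IsMittagLeffler : Prop :=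
  ∀ (ι : Type u) (Q : ι → Type u) [∀ i, AddCommGroup (Q i)] [∀ i, Module R (Q i)],
    Function.Injective (mlCompare R M Q)

/-- A right `R`-module `M` is flat if tensoring with `M` preserves injectivity of maps
of left `R`-modules. -/
def IsRightFlat : Prop :=
  ∀ (Q Q' : Type u) [AddCommGroup Q] [AddCommGroup Q'] [Module R Q] [Module R Q']
    (f : Q →ₗ[R] Q'), Function.Injective f →
      Function.Injective (NCTensor.map (M := M) f)

end NCTensor
section ExtGroup

open CategoryTheory

/-- The first Ext group `Ext¹_R(X, Y)` of two right `R`-modules, as a `ℤ`-module. -/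
noncomputable def ext1 (R : Type u) [Ring R] (X Y : ModuleCat.{u} Rᵐᵒᵖ) : ModuleCat ℤ :=
  ((_root_.Ext ℤ (ModuleCat.{u} Rᵐᵒᵖ) 1).obj (Opposite.op X)).obj Y

end ExtGroup

section Chains

/-- The transition maps of the directed system associated to a chain
`F 0 → F 1 → F 2 → ⋯` of module homomorphisms. -/
noncomputable def chainTransitionMap {S : Type u} [Ring S] {F : ℕ → Type u}
    [∀ n, AddCommGroup (F n)] [∀ n, Module S (F n)]
    (u : ∀ n, F n →ₗ[S] F (n + 1)) :
    ∀ i j : ℕ, i ≤ j → (F i →ₗ[S] F j) := fun i _ h =>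
  Nat.leRecOn (C := fun k => F i →ₗ[S] F k) h (fun {k} g => (u k).comp g) LinearMap.id

/-- The direct limit (colimit) of a chain `F 0 → F 1 → F 2 → ⋯` of module
homomorphisms. -/
noncomputable def chainDirectLimit {S : Type u} [Ring S] (F : ℕ → Type u)
    [∀ n, AddCommGroup (F n)] [∀ n, Module S (F n)]
    (u : ∀ n, F n →ₗ[S] F (n + 1)) : Type u :=
  Module.DirectLimit F (chainTransitionMap u)

noncomputable instance {S : Type u} [Ring S] (F : ℕ → Type u)
    [∀ n, AddCommGroup (F n)] [∀ n, Module S (F n)]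
    (u : ∀ n, F n →ₗ[S] F (n + 1)) : AddCommGroup (chainDirectLimit F u) :=
  inferInstanceAs (AddCommGroup (Module.DirectLimit F (chainTransitionMap u)))

noncomputable instance {S : Type u} [Ring S] (F : ℕ → Type u)
    [∀ n, AddCommGroup (F n)] [∀ n, Module S (F n)]
    (u : ∀ n, F n →ₗ[S] F (n + 1)) : Module S (chainDirectLimit F u) :=
  inferInstanceAs (Module S (Module.DirectLimit F (chainTransitionMap u)))

end Chains

lemma LinearMap.exists_comp_eq_of_ker_le {S : Type*} [Ring S] {A B C : Type*} [AddCommGroup A]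
    [AddCommGroup B] [AddCommGroup C] [Module S A] [Module S B] [Module S C]
    {q : A →ₗ[S] B} (hq : Function.Surjective q) {f : A →ₗ[S] C}
    (h : LinearMap.ker q ≤ LinearMap.ker f) : ∃ g : B →ₗ[S] C, ∀ a, g (q a) = f a := by
  let e := q.quotKerEquivOfSurjective hq
  refine ⟨(LinearMap.ker q).liftQ f h ∘ₗ e.symm.toLinearMap, fun a => ?_⟩
  have h2 : e.symm (q a) = Submodule.Quotient.mk a := by
    rw [LinearEquiv.symm_apply_eq]
    rfl
  simp [h2]

section ExtCriterion

open CategoryTheory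

/-- `Y` has the extension property with respect to all short exact sequences
`0 → K → B → X → 0`. -/
def HasExtensionProperty (S : Type u) [Ring S] (X Y : Type u) [AddCommGroup X] [Module S X]
    [AddCommGroup Y] [Module S Y] : Prop :=
  ∀ (K B : Type u) [AddCommGroup K] [Module S K] [AddCommGroup B] [Module S B]
    (i : K →ₗ[S] B) (p : B →ₗ[S] X), Function.Injective i → Function.Surjective p →
    Function.Exact i p → ∀ φ : K →ₗ[S] Y, ∃ ψ : B →ₗ[S] Y, ∀ k, ψ (i k) = φ k

lemma subsingleton_ext1_iff_resolution {R : Type u} [Ring R] {X : ModuleCat.{u} Rᵐᵒᵖ}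
    (P : ProjectiveResolution X) (Y : ModuleCat.{u} Rᵐᵒᵖ) :
    Subsingleton (ext1 R X Y) ↔
      ∀ f : P.complex.X 1 ⟶ Y, P.complex.d 2 1 ≫ f = 0 →
        ∃ g : P.complex.X 0 ⟶ Y, P.complex.d 1 0 ≫ g = f := by
  rw [← ModuleCat.isZero_iff_subsingleton, ext1, (P.isoExt (R := ℤ) 1 Y).isZero_iff,
    ← HomologicalComplex.exactAt_iff_isZero_homology,
    HomologicalComplex.exactAt_iff' _ 0 1 2 (by simp) (by simp),
    ShortComplex.moduleCat_exact_iff]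
  rfl

lemma exists_projective_presentation_ext1 {R : Type u} [Ring R] (X : ModuleCat.{u} Rᵐᵒᵖ) :
    ∃ (P₂ P₁ P₀ : ModuleCat.{u} Rᵐᵒᵖ) (d₂ : P₂ →ₗ[Rᵐᵒᵖ] P₁) (d₁ : P₁ →ₗ[Rᵐᵒᵖ] P₀)
      (ε : P₀ →ₗ[Rᵐᵒᵖ] X), Module.Projective Rᵐᵒᵖ P₀ ∧ Module.Projective Rᵐᵒᵖ P₁ ∧
      Function.Exact d₂ d₁ ∧ Function.Exact d₁ ε ∧ Function.Surjective ε ∧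
      ∀ Y : ModuleCat.{u} Rᵐᵒᵖ, Subsingleton (ext1 R X Y) ↔
        ∀ f : P₁ →ₗ[Rᵐᵒᵖ] Y, f ∘ₗ d₂ = 0 → ∃ g : P₀ →ₗ[Rᵐᵒᵖ] Y, g ∘ₗ d₁ = f := by
  obtain ⟨P⟩ := (inferInstance : HasProjectiveResolution X).out
  refine ⟨P.complex.X 2, P.complex.X 1, P.complex.X 0, (P.complex.d 2 1).hom,
    (P.complex.d 1 0).hom, (P.π.f 0).hom, ?_, ?_, ?_, ?_, ?_, fun Y => ?_⟩
  · exact (IsProjective.iff_projective _).2 (P.projective 0)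
  · exact (IsProjective.iff_projective _).2 (P.projective 1)
  · exact (ShortComplex.ShortExact.moduleCat_exact_iff_function_exact _).1 (P.exact_succ 0)
  · exact (ShortComplex.ShortExact.moduleCat_exact_iff_function_exact _).1 P.exact₀
  · exact (ModuleCat.epi_iff_surjective _).1 (inferInstanceAs (Epi (P.π.f 0)))
  · rw [subsingleton_ext1_iff_resolution P Y]
    constructor
    · intro h f hf
      obtain ⟨g, hg⟩ := h (ModuleCat.ofHom f) (by ext x; exact LinearMap.congr_fun hf x)
      exact ⟨g.hom, by rw [← ModuleCat.hom_comp, hg]; rfl⟩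
    · intro h f hf
      obtain ⟨g, hg⟩ := h f.hom (by rw [← ModuleCat.hom_comp, hf]; rfl)
      exact ⟨ModuleCat.ofHom g, by ext x; exact LinearMap.congr_fun hg x⟩

lemma subsingleton_ext1_iff_hasExtensionProperty {R : Type u} [Ring R]
    (X Y : ModuleCat.{u} Rᵐᵒᵖ) :
    Subsingleton (ext1 R X Y) ↔ HasExtensionProperty Rᵐᵒᵖ X Y := by
  obtain ⟨P₂, P₁, P₀, d₂, d₁, ε, hP₀, hP₁, h₂₁, h₁₀, hε, hext⟩ :=
    exists_projective_presentation_ext1 X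
  rw [hext Y]
  constructor
  · intro h K B _ _ _ _ i p hi hp hip φ
    obtain ⟨a, ha⟩ := Module.projective_lifting_property p ε hp
    have ha' : ∀ y, p (a y) = ε y := LinearMap.congr_fun ha
    obtain ⟨b, hb⟩ := Module.projective_lifting_property i.rangeRestrict
      ((a ∘ₗ d₁).codRestrict (LinearMap.range i) fun w =>
        (hip _).1 (by simp [ha', h₁₀.apply_apply_eq_zero])) i.surjective_rangeRestrict
    have hb' : ∀ w, i (b w) = a (d₁ w) := fun w =>
      congrArg Subtype.val (LinearMap.congr_fun hb w)
    obtain ⟨c, hc⟩ := h (φ ∘ₗ b) (by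
      ext v
      have : b (d₂ v) = 0 := hi (by simp [hb', h₂₁.apply_apply_eq_zero])
      simp [this])
    have hc' : ∀ w, c (d₁ w) = φ (b w) := LinearMap.congr_fun hc
    have hsurj : Function.Surjective (i.coprod a) := by
      intro x
      obtain ⟨y, hy⟩ := hε (p x)
      obtain ⟨k, hk⟩ := (hip (x - a y)).1 (by simp [ha', hy])
      exact ⟨(k, y), by simp [hk]⟩
    have hker : LinearMap.ker (i.coprod a) ≤ LinearMap.ker (φ.coprod c) := by
      rintro ⟨k, y⟩ hky
      simp only [LinearMap.mem_ker, LinearMap.coprod_apply] at hky ⊢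
      have hy : ε y = 0 := by
        have := congrArg p hky
        simpa [ha', hip.apply_apply_eq_zero] using this
      obtain ⟨w, rfl⟩ := (h₁₀ y).1 hy
      have : k + b w = 0 := hi (by simp [hb', hky])
      rw [hc', ← map_add, this, map_zero]
    obtain ⟨ψ, hψ⟩ := LinearMap.exists_comp_eq_of_ker_le hsurj hker
    exact ⟨ψ, fun k => by simpa using hψ (k, 0)⟩
  · intro h f hf
    have hle : LinearMap.ker (d₁.rangeRestrict) ≤ LinearMap.ker f := by
      intro w hw
      obtain ⟨v, rfl⟩ := (h₂₁ w).1 (by simpa using congrArg Subtype.val hw)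
      exact LinearMap.congr_fun hf v
    obtain ⟨g, hg⟩ := LinearMap.exists_comp_eq_of_ker_le d₁.surjective_rangeRestrict hle
    obtain ⟨ψ, hψ⟩ := h (LinearMap.range d₁) P₀ (LinearMap.range d₁).subtype ε
      (Submodule.subtype_injective _) hε (fun y => by rw [h₁₀ y]; simp) g
    exact ⟨ψ, LinearMap.ext fun w => (hψ (d₁.rangeRestrict w)).trans (hg w)⟩

end ExtCriterion

section Chain

variable {S : Type u} [Ring S] {F : ℕ → Type u} [∀ n, AddCommGroup (F n)] [∀ n, Module S (F n)]
  (t : ∀ n, F n →ₗ[S] F (n + 1))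

lemma chainTransitionMap_self (n : ℕ) : chainTransitionMap t n n le_rfl = LinearMap.id :=
  Nat.leRecOn_self _

lemma chainTransitionMap_succ {n m : ℕ} (h : n ≤ m) :
    chainTransitionMap t n (m + 1) (h.trans m.le_succ) = t m ∘ₗ chainTransitionMap t n m h :=
  Nat.leRecOn_succ h _

lemma chainTransitionMap_succ_left {n m : ℕ} (h : n + 1 ≤ m) :
    chainTransitionMap t n m (n.le_succ.trans h) = chainTransitionMap t (n + 1) m h ∘ₗ t n := by
  induction m, h using Nat.le_induction with
  | base =>
    rw [chainTransitionMap_succ t le_rfl, chainTransitionMap_self, chainTransitionMap_self]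
    rfl
  | succ m h ih =>
    rw [chainTransitionMap_succ t (n.le_succ.trans h), chainTransitionMap_succ t h, ih]
    rfl

instance : DirectedSystem F fun i j h => chainTransitionMap t i j h where
  map_self i x := by rw [chainTransitionMap_self]; rfl
  map_map k j i hij hjk x := by
    induction k, hjk using Nat.le_induction with
    | base => rw [chainTransitionMap_self]; rfl
    | succ k hjk ih =>
      rw [chainTransitionMap_succ t hjk, chainTransitionMap_succ t (hij.trans hjk)]
      exact congrArg (t k) ih

/-- The canonical maps into the direct limit of a chain. -/
noncomputable def chainDirectLimit.of (n : ℕ) : F n →ₗ[S] chainDirectLimit F t :=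
  Module.DirectLimit.of S ℕ F (chainTransitionMap t) n

lemma chainDirectLimit.of_succ (n : ℕ) (x : F n) :
    chainDirectLimit.of t (n + 1) (t n x) = chainDirectLimit.of t n x := by
  have h : chainTransitionMap t n (n + 1) n.le_succ x = t n x := by
    rw [chainTransitionMap_succ t le_rfl, chainTransitionMap_self]
    rfl
  rw [← h]
  exact Module.DirectLimit.of_f

lemma chainDirectLimit.exists_of (z : chainDirectLimit F t) :
    ∃ n x, chainDirectLimit.of t n x = z :=
  Module.DirectLimit.exists_of z

lemma chainDirectLimit.exists_eq_of_of_eq {n m : ℕ} {x : F n} {y : F m}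
    (h : chainDirectLimit.of t n x = chainDirectLimit.of t m y) :
    ∃ (k : ℕ) (hn : n ≤ k) (hm : m ≤ k),
      chainTransitionMap t n k hn x = chainTransitionMap t m k hm y := by
  have key : chainDirectLimit.of t (max n m) (chainTransitionMap t n _ (le_max_left n m) x) =
      chainDirectLimit.of t (max n m) (chainTransitionMap t m _ (le_max_right n m) y) :=
    Module.DirectLimit.of_f.trans (h.trans Module.DirectLimit.of_f.symm)
  obtain ⟨k, hk, hxy⟩ := Module.DirectLimit.exists_eq_of_of_eq key
  refine ⟨k, (le_max_left n m).trans hk, (le_max_right n m).trans hk, ?_⟩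
  rwa [DirectedSystem.map_map (f := fun i j h => chainTransitionMap t i j h),
    DirectedSystem.map_map (f := fun i j h => chainTransitionMap t i j h)] at hxy

/-- Vanishing of the obstruction in `lim¹ Hom(F n, C)` together with the extension property for
each term of the chain gives the extension property for the direct limit. -/
lemma HasExtensionProperty.chainDirectLimit {C : Type u} [AddCommGroup C] [Module S C]
    (hF : ∀ n, HasExtensionProperty S (F n) C)
    (hlim : ∀ c : ∀ n, F n →ₗ[S] C, ∃ d : ∀ n, F n →ₗ[S] C,
      ∀ n x, c n x = d n x - d (n + 1) (t n x)) :
    HasExtensionProperty S (chainDirectLimit F t) C := by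
  intro K P _ _ _ _ i p hi hp hip φ
  let Q : ∀ n, Submodule S (P × F n) := fun n =>
    LinearMap.ker ((p ∘ₗ LinearMap.fst S P (F n)) - chainDirectLimit.of t n ∘ₗ LinearMap.snd S P _)
  have hQ : ∀ {n} {z : P × F n}, z ∈ Q n ↔ p z.1 = chainDirectLimit.of t n z.2 := by
    intro n z
    simp [Q, sub_eq_zero]
  let q : ∀ n, Q n →ₗ[S] F n := fun n => LinearMap.snd S P (F n) ∘ₗ (Q n).subtype
  have hq : ∀ n, Function.Surjective (q n) := fun n x => by
    obtain ⟨y, hy⟩ := hp (chainDirectLimit.of t n x)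
    exact ⟨⟨(y, x), hQ.2 hy⟩, rfl⟩
  have hpi : ∀ k, p (i k) = 0 := hip.apply_apply_eq_zero
  let s : ∀ n, K →ₗ[S] Q n := fun n => (LinearMap.inl S P (F n) ∘ₗ i).codRestrict (Q n)
    fun k => hQ.2 (by simp [hpi])
  have hs : ∀ n, Function.Injective (s n) := fun n a b hab =>
    hi (congrArg (fun z : Q n => z.1.1) hab)
  have hsq : ∀ n, Function.Exact (s n) (q n) := by
    rintro n ⟨⟨y, x⟩, hz⟩
    constructor
    · rintro (rfl : x = 0)
      obtain ⟨k, rfl⟩ := (hip y).1 (by simpa using hQ.1 hz)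
      exact ⟨k, rfl⟩
    · rintro ⟨k, hk⟩
      exact (congrArg (fun z : Q n => z.1.2) hk).symm
  choose ψ hψ using fun n => hF n K (Q n) (s n) (q n) (hs n) (hq n) (hsq n) φ
  let j : ∀ n, Q n →ₗ[S] Q (n + 1) := fun n =>
    (LinearMap.prodMap LinearMap.id (t n) ∘ₗ (Q n).subtype).codRestrict (Q (n + 1))
      fun z => hQ.2 (by
        rw [LinearMap.comp_apply, LinearMap.prodMap_apply, chainDirectLimit.of_succ]
        exact hQ.1 z.2)
  have hc : ∀ n, ∃ c : F n →ₗ[S] C, ∀ z, c (q n z) = (ψ n - ψ (n + 1) ∘ₗ j n) z := fun n => by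
    refine LinearMap.exists_comp_eq_of_ker_le (hq n) fun z hz => ?_
    obtain ⟨k, rfl⟩ := (hsq n z).1 hz
    have : j n (s n k) = s (n + 1) k := by
      ext
      · rfl
      · exact map_zero (t n)
    simp [this, hψ]
  choose c hc using hc
  obtain ⟨d, hd⟩ := hlim c
  let χ : ∀ n, Q n →ₗ[S] C := fun n => ψ n - d n ∘ₗ q n
  have hχj : ∀ n z, χ (n + 1) (j n z) = χ n z := fun n z => by
    have h1 := hc n z
    rw [hd] at h1
    have h2 : q (n + 1) (j n z) = t n (q n z) := rfl
    simp only [χ, LinearMap.sub_apply, LinearMap.comp_apply, h2] at h1 ⊢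
    rw [sub_eq_sub_iff_sub_eq_sub, ← neg_sub, ← h1]
    abel
  have hχtr : ∀ {n m} (h : n ≤ m) (y : P) (x : F n) (hz : (y, x) ∈ Q n),
      ∃ hz' : (y, chainTransitionMap t n m h x) ∈ Q m, χ m ⟨_, hz'⟩ = χ n ⟨_, hz⟩ := by
    intro n m h y x hz
    induction m, h using Nat.le_induction with
    | base => simpa only [chainTransitionMap_self, LinearMap.id_apply, exists_prop, and_true]
    | succ m h ih =>
      obtain ⟨hz', he⟩ := ih
      rw [← he, ← hχj]
      refine ⟨?_, ?_⟩
      · rw [chainTransitionMap_succ t h]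
        exact (j m ⟨(y, chainTransitionMap t n m h x), hz'⟩).2
      · congr 1
        ext
        · rfl
        · exact LinearMap.congr_fun (chainTransitionMap_succ t h) x
  have hχ : ∀ {n m} (y : P) (x : F n) (x' : F m) (hz : (y, x) ∈ Q n) (hz' : (y, x') ∈ Q m),
      χ n ⟨_, hz⟩ = χ m ⟨_, hz'⟩ := by
    intro n m y x x' hz hz'
    have e : chainDirectLimit.of t n x = chainDirectLimit.of t m x' :=
      (hQ.1 hz).symm.trans (hQ.1 hz')
    obtain ⟨k, hn, hm, hxy⟩ := chainDirectLimit.exists_eq_of_of_eq t e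
    obtain ⟨h1, h2⟩ := hχtr hn y x hz
    obtain ⟨h3, h4⟩ := hχtr hm y x' hz'
    rw [← h2, ← h4]
    simp only [hxy]
  have hex : ∀ y : P, ∃ n x, (y, x) ∈ Q n := fun y => by
    obtain ⟨n, x, hx⟩ := chainDirectLimit.exists_of t (p y)
    exact ⟨n, x, hQ.2 hx.symm⟩
  choose N X hX using hex
  have hval : ∀ {n} (y : P) (x : F n) (hz : (y, x) ∈ Q n), χ (N y) ⟨_, hX y⟩ = χ n ⟨_, hz⟩ :=
    fun y x hz => hχ y _ _ _ _
  refine ⟨{ toFun := fun y => χ (N y) ⟨_, hX y⟩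
            map_add' := fun y y' => ?_
            map_smul' := fun r y => ?_ }, fun k => ?_⟩
  · obtain ⟨h1, e1⟩ := hχtr (le_max_left (N y) (N y')) y _ (hX y)
    obtain ⟨h2, e2⟩ := hχtr (le_max_right (N y) (N y')) y' _ (hX y')
    rw [← e1, ← e2, ← map_add]
    exact hval _ _ (add_mem h1 h2)
  · rw [RingHom.id_apply, ← map_smul]
    exact hval _ _ ((Q (N y)).smul_mem r (hX y))
  · refine (hval (i k) (0 : F 0) (s 0 k).2).trans ?_
    change χ 0 (s 0 k) = φ k
    have : q 0 (s 0 k) = 0 := rfl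
    simp [χ, hψ, this]

end Chain

section NCTensor

variable {R : Type u} [Ring R] {M M' : Type u} [AddCommGroup M] [Module Rᵐᵒᵖ M]
  [AddCommGroup M'] [Module Rᵐᵒᵖ M'] {Q : Type u} [AddCommGroup Q] [Module R Q]

lemma NCTensor.induction_on {p : NCTensor R M Q → Prop} (z : NCTensor R M Q)
    (h0 : p 0) (ht : ∀ m q, p (NCTensor.mk R M Q (m ⊗ₜ q)))
    (ha : ∀ x y, p x → p y → p (x + y)) : p z := by
  obtain ⟨z, rfl⟩ := QuotientAddGroup.mk'_surjective (balancedSub R M Q) z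
  change p (NCTensor.mk R M Q z)
  induction z using TensorProduct.induction_on with
  | zero => simpa using h0
  | tmul m q => exact ht m q
  | add x y hx hy => rw [map_add]; exact ha _ _ hx hy

lemma NCTensor.addHom_ext {G : Type*} [AddCommGroup G] {f g : NCTensor R M Q →+ G}
    (h : ∀ m q, f (NCTensor.mk R M Q (m ⊗ₜ q)) = g (NCTensor.mk R M Q (m ⊗ₜ q))) : f = g := by
  ext z
  induction z using NCTensor.induction_on with
  | h0 => simp
  | ht m q => exact h m q
  | ha x y hx hy => rw [map_add, map_add, hx, hy]

lemma NCTensor.mk_smul_tmul (r : R) (m : M) (q : Q) :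
    NCTensor.mk R M Q ((MulOpposite.op r • m) ⊗ₜ q) = NCTensor.mk R M Q (m ⊗ₜ (r • q)) := by
  rw [← sub_eq_zero, ← map_sub]
  exact (QuotientAddGroup.eq_zero_iff _).2 (AddSubgroup.subset_closure ⟨m, r, q, rfl⟩)

variable (Q) in
/-- The map `M ⊗_R Q →+ M' ⊗_R Q` induced by a map of right `R`-modules `f : M → M'`. -/
noncomputable def NCTensor.mapLeft (f : M →ₗ[Rᵐᵒᵖ] M') : NCTensor R M Q →+ NCTensor R M' Q :=
  QuotientAddGroup.lift (balancedSub R M Q)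
    ((NCTensor.mk R M' Q).comp
      (LinearMap.rTensor Q f.toAddMonoidHom.toIntLinearMap).toAddMonoidHom)
    (by
      intro x hx
      refine (AddSubgroup.closure_le (K := AddMonoidHom.ker _)).2 ?_ hx
      rintro _ ⟨m, r, q, rfl⟩
      have h := NCTensor.mk_smul_tmul r (f m) q
      rw [← sub_eq_zero, ← map_sub, ← map_smul] at h
      simpa using h)

@[simp]
lemma NCTensor.mapLeft_mk_tmul (f : M →ₗ[Rᵐᵒᵖ] M') (m : M) (q : Q) :
    NCTensor.mapLeft Q f (NCTensor.mk R M Q (m ⊗ₜ q)) = NCTensor.mk R M' Q (f m ⊗ₜ q) :=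
  rfl

lemma NCTensor.map_mapLeft {Q' : Type u} [AddCommGroup Q'] [Module R Q'] (f : M →ₗ[Rᵐᵒᵖ] M')
    (g : Q →ₗ[R] Q') (z : NCTensor R M Q) :
    NCTensor.map g (NCTensor.mapLeft Q f z) = NCTensor.mapLeft Q' f (NCTensor.map g z) :=
  DFunLike.congr_fun (NCTensor.addHom_ext (f := (NCTensor.map g).comp (NCTensor.mapLeft Q f))
    (g := (NCTensor.mapLeft Q' f).comp (NCTensor.map g)) fun _ _ => rfl) z

lemma mlCompare_mapLeft {ι : Type u} (P : ι → Type u) [∀ i, AddCommGroup (P i)]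
    [∀ i, Module R (P i)] (f : M →ₗ[Rᵐᵒᵖ] M') (z : NCTensor R M (∀ i, P i)) (i : ι) :
    mlCompare R M' P (NCTensor.mapLeft _ f z) i =
      NCTensor.mapLeft (P i) f (mlCompare R M P z i) := by
  induction z using NCTensor.induction_on with
  | h0 => simp
  | ht m q => rfl
  | ha x y hx hy => simp only [map_add, Pi.add_apply, hx, hy]

/-- Let `π τ : M → G τ` be a family of maps, and suppose that the identity of `M` is pointwise
eventually equal to finite sums of maps factoring through the `π τ`. Then the `π τ ⊗ Q` are
jointly injective for every left module `Q`. -/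
lemma NCTensor.eq_zero_of_mapLeft_eq_zero {T : Type*} {G : T → Type u}
    [∀ τ, AddCommGroup (G τ)] [∀ τ, Module Rᵐᵒᵖ (G τ)] (π : ∀ τ, M →ₗ[Rᵐᵒᵖ] G τ)
    {I : Type*} {l : Filter I} [l.NeBot] (Φ : I → M →ₗ[Rᵐᵒᵖ] M)
    (hΦ : ∀ i, Φ i ∈ AddSubgroup.closure {f | ∃ τ, ∃ σ : G τ →ₗ[Rᵐᵒᵖ] M, f = σ ∘ₗ π τ})
    (hid : ∀ m, ∀ᶠ i in l, Φ i m = m) (z : NCTensor R M Q)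
    (hz : ∀ τ, NCTensor.mapLeft Q (π τ) z = 0) : z = 0 := by
  have h1 : ∀ᶠ i in l, NCTensor.mapLeft Q (Φ i) z = z := by
    clear hz
    induction z using NCTensor.induction_on with
    | h0 => simp
    | ht m q =>
      filter_upwards [hid m] with i hi
      rw [NCTensor.mapLeft_mk_tmul, hi]
    | ha x y hx hy =>
      filter_upwards [hx, hy] with i hx hy
      rw [map_add, hx, hy]
  have hadd : ∀ f g : M →ₗ[Rᵐᵒᵖ] M,
      NCTensor.mapLeft Q (f + g) = NCTensor.mapLeft Q f + NCTensor.mapLeft Q g := fun f g =>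
    NCTensor.addHom_ext fun m q => by simp [TensorProduct.add_tmul]
  let Λ : (M →ₗ[Rᵐᵒᵖ] M) →+ NCTensor R M Q :=
    AddMonoidHom.mk' (fun f => NCTensor.mapLeft Q f z) fun f g => by rw [hadd]; rfl
  obtain ⟨i, hi⟩ := h1.exists
  rw [← hi]
  refine (AddSubgroup.closure_le (K := Λ.ker)).2 ?_ (hΦ i)
  rintro _ ⟨τ, σ, rfl⟩
  have hcomp : NCTensor.mapLeft Q (σ ∘ₗ π τ) =
      (NCTensor.mapLeft Q σ).comp (NCTensor.mapLeft Q (π τ)) :=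
    NCTensor.addHom_ext fun m q => rfl
  change NCTensor.mapLeft Q (σ ∘ₗ π τ) z = 0
  rw [hcomp, AddMonoidHom.comp_apply, hz, map_zero]

lemma IsRightFlat.of_jointly_injective {T : Type*} {G : T → Type u}
    [∀ τ, AddCommGroup (G τ)] [∀ τ, Module Rᵐᵒᵖ (G τ)] (π : ∀ τ, M →ₗ[Rᵐᵒᵖ] G τ)
    (hπ : ∀ (Q : Type u) [AddCommGroup Q] [Module R Q] (z : NCTensor R M Q),
      (∀ τ, NCTensor.mapLeft Q (π τ) z = 0) → z = 0)
    (hG : ∀ τ, IsRightFlat R (G τ)) : IsRightFlat R M := by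
  intro Q Q' _ _ _ _ f hf
  refine (injective_iff_map_eq_zero _).2 fun z hz => hπ Q z fun τ => ?_
  refine (injective_iff_map_eq_zero _).1 (hG τ Q Q' f hf) _ ?_
  rw [NCTensor.map_mapLeft, hz, map_zero]

lemma IsMittagLeffler.of_jointly_injective {T : Type*} {G : T → Type u}
    [∀ τ, AddCommGroup (G τ)] [∀ τ, Module Rᵐᵒᵖ (G τ)] (π : ∀ τ, M →ₗ[Rᵐᵒᵖ] G τ)
    (hπ : ∀ (Q : Type u) [AddCommGroup Q] [Module R Q] (z : NCTensor R M Q),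
      (∀ τ, NCTensor.mapLeft Q (π τ) z = 0) → z = 0)
    (hG : ∀ τ, IsMittagLeffler R (G τ)) : IsMittagLeffler R M := by
  intro ι P _ _
  refine (injective_iff_map_eq_zero _).2 fun z hz => hπ _ z fun τ => ?_
  refine (injective_iff_map_eq_zero _).1 (hG τ ι P) _ ?_
  funext i
  rw [mlCompare_mapLeft, hz]
  simp

end NCTensor

section TreeModule

variable {S : Type u} [Ring S] {F : ℕ → Type u} [∀ n, AddCommGroup (F n)] [∀ n, Module S (F n)]
  (t : ∀ n, F n →ₗ[S] F (n + 1)) {A B : Type u} (h : A → ℕ → B)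

open scoped Classical in
/-- The relations of the tree module: they identify the generator at level `n` of a branch with
the sum of its generator at level `n + 1` and the node it passes through at level `n`. -/
noncomputable def treeRel : (⨁ p : A × ℕ, F p.2) →ₗ[S]
    (⨁ p : A × ℕ, F p.2) × (⨁ p : ℕ × B, F p.1) :=
  DirectSum.toModule S (A × ℕ) _ fun p =>
    (DirectSum.lof S (A × ℕ) (fun p => F p.2) p -
      DirectSum.lof S (A × ℕ) (fun p => F p.2) (p.1, p.2 + 1) ∘ₗ t p.2).prod
      (-DirectSum.lof S (ℕ × B) (fun p => F p.1) (p.2, h p.1 p.2))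

open scoped Classical in
lemma treeRel_lof (a : A) (m : ℕ) (x : F m) :
    treeRel t h (DirectSum.lof S (A × ℕ) (fun p => F p.2) (a, m) x) =
      (DirectSum.lof S (A × ℕ) (fun p => F p.2) (a, m) x -
        DirectSum.lof S (A × ℕ) (fun p => F p.2) (a, m + 1) (t m x),
        -DirectSum.lof S (ℕ × B) (fun p => F p.1) (m, h a m) x) := by
  rw [treeRel, DirectSum.toModule_lof]
  rfl

/-- The tree module of a chain `F 0 → F 1 → ⋯` along a family `h` of branches, in which `h a n`
is the node at level `n` of the branch `a`. -/
abbrev TreeModule : Type u :=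
  ((⨁ p : A × ℕ, F p.2) × (⨁ p : ℕ × B, F p.1)) ⧸ LinearMap.range (treeRel t h)

namespace TreeModule

open scoped Classical in
/-- The generators of the tree module associated to the tail of a branch. -/
noncomputable def tail (a : A) (n : ℕ) : F n →ₗ[S] TreeModule t h :=
  (LinearMap.range (treeRel t h)).mkQ ∘ₗ LinearMap.inl S _ _ ∘ₗ
    DirectSum.lof S (A × ℕ) (fun p => F p.2) (a, n)

open scoped Classical in
/-- The generators of the tree module associated to a node. -/
noncomputable def node (n : ℕ) (b : B) : F n →ₗ[S] TreeModule t h :=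
  (LinearMap.range (treeRel t h)).mkQ ∘ₗ LinearMap.inr S _ _ ∘ₗ
    DirectSum.lof S (ℕ × B) (fun p => F p.1) (n, b)

lemma tail_eq (a : A) (n : ℕ) (x : F n) :
    tail t h a n x = tail t h a (n + 1) (t n x) + node t h n (h a n) x := by
  classical
  rw [← sub_eq_zero, tail, tail, node]
  simp only [LinearMap.comp_apply, ← map_add, ← map_sub]
  rw [Submodule.mkQ_apply, Submodule.Quotient.mk_eq_zero]
  refine ⟨DirectSum.lof S (A × ℕ) (fun p => F p.2) (a, n) x, ?_⟩
  rw [treeRel_lof]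
  ext <;> simp

variable {t h} in
lemma induction_on {p : TreeModule t h → Prop} (z : TreeModule t h) (h0 : p 0)
    (htail : ∀ a n x, p (tail t h a n x)) (hnode : ∀ n b x, p (node t h n b x))
    (hadd : ∀ x y, p x → p y → p (x + y)) : p z := by
  classical
  obtain ⟨⟨x, y⟩, rfl⟩ := (LinearMap.range (treeRel t h)).mkQ_surjective z
  have : (x, y) = LinearMap.inl S _ _ x + LinearMap.inr S _ _ y := by simp
  rw [this, map_add]
  refine hadd _ _ ?_ ?_
  · induction x using DirectSum.induction_on with
    | zero => rw [map_zero, map_zero]; exact h0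
    | of i x => exact htail i.1 i.2 x
    | add x y hx hy => rw [map_add, map_add]; exact hadd _ _ (hx (by simp)) (hy (by simp))
  · induction y using DirectSum.induction_on with
    | zero => rw [map_zero, map_zero]; exact h0
    | of i x => exact hnode i.1 i.2 x
    | add x y hx hy => rw [map_add, map_add]; exact hadd _ _ (hx (by simp)) (hy (by simp))

open scoped Classical in
/-- The coordinate of the tree module at a node. -/
noncomputable def coord (n : ℕ) (b : B) : TreeModule t h →ₗ[S] F n :=
  (LinearMap.range (treeRel t h)).liftQ
    ((DirectSum.toModule S (A × ℕ) (F n) fun p =>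
      if hp : p.2 ≤ n ∧ h p.1 n = b then chainTransitionMap t p.2 n hp.1 else 0).coprod
      (DirectSum.component S (ℕ × B) (fun p => F p.1) (n, b)))
    (by
      rw [LinearMap.range_le_ker_iff]
      refine DirectSum.linearMap_ext _ fun ⟨a, m⟩ => LinearMap.ext fun x => ?_
      simp only [LinearMap.comp_apply, treeRel_lof, DirectSum.toModule_lof,
        LinearMap.coprod_apply, map_sub, map_neg, LinearMap.zero_apply]
      rcases lt_trichotomy m n with hmn | rfl | hmn
      · have hne : (n, b) ≠ (m, h a m) := fun e => hmn.ne (congrArg Prod.fst e).symm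
        rw [DirectSum.component.of, dif_neg (Ne.symm hne), neg_zero, add_zero, sub_eq_zero]
        by_cases hb : h a n = b
        · rw [dif_pos ⟨hmn.le, hb⟩, dif_pos ⟨hmn, hb⟩, chainTransitionMap_succ_left t hmn]
          rfl
        · rw [dif_neg (fun e => hb e.2), dif_neg (fun e => hb e.2)]
          rfl
      · by_cases hb : h a m = b
        · subst hb
          rw [dif_pos ⟨le_refl m, rfl⟩, dif_neg (fun e => absurd e.1 (by simp)),
            chainTransitionMap_self, DirectSum.component.lof_self]
          simp
        · have hne : (m, b) ≠ (m, h a m) := fun e => hb (congrArg Prod.snd e).symm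
          rw [DirectSum.component.of, dif_neg (Ne.symm hne), dif_neg (fun e => hb e.2),
            dif_neg (fun e => hb e.2)]
          simp
      · have hne : (n, b) ≠ (m, h a m) := fun e => hmn.ne (congrArg Prod.fst e)
        rw [DirectSum.component.of, dif_neg (Ne.symm hne), dif_neg (fun e => absurd e.1 (by omega)),
          dif_neg (fun e => absurd e.1 (by simp; omega))]
        simp)

lemma coord_tail {a : A} {m n : ℕ} (hmn : m ≤ n) (x : F m) :
    coord t h n (h a n) (tail t h a m x) = chainTransitionMap t m n hmn x := by
  classical
  simp [coord, tail, hmn]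

lemma coord_tail_of_lt (a : A) {m n : ℕ} (hmn : n < m) (b : B) (x : F m) :
    coord t h n b (tail t h a m x) = 0 := by
  classical
  have : ¬ (m ≤ n ∧ h a n = b) := fun e => absurd e.1 (by omega)
  simp [coord, tail, this]

lemma coord_tail_of_ne {a : A} {n : ℕ} {b : B} (hb : h a n ≠ b) (m : ℕ) (x : F m) :
    coord t h n b (tail t h a m x) = 0 := by
  classical
  have : ¬ (m ≤ n ∧ h a n = b) := fun e => hb e.2
  simp [coord, tail, this]

lemma coord_node_self (n : ℕ) (b : B) (x : F n) :
    coord t h n b (node t h n b x) = x := by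
  classical
  simp [coord, node]

lemma coord_node_of_ne {n m : ℕ} {b b' : B} (hne : (m, b') ≠ (n, b)) (x : F m) :
    coord t h n b (node t h m b' x) = 0 := by
  classical
  simp [coord, node, DirectSum.component.of, hne]

/-- The finite approximation of the identity of the tree module given by the tails at level `N`
of the branches in `s` and the nodes in `b` below level `N`. -/
noncomputable def approx (s : Finset A) (N : ℕ) (b : Finset B) :
    TreeModule t h →ₗ[S] TreeModule t h :=
  ∑ a ∈ s, tail t h a N ∘ₗ coord t h N (h a N) +
    ∑ k ∈ Finset.range N, ∑ b ∈ b, node t h k b ∘ₗ coord t h k b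

lemma approx_apply (s : Finset A) (N : ℕ) (b : Finset B) (z : TreeModule t h) :
    approx t h s N b z = ∑ a ∈ s, tail t h a N (coord t h N (h a N) z) +
      ∑ k ∈ Finset.range N, ∑ b ∈ b, node t h k b (coord t h k b z) := by
  simp [approx, LinearMap.sum_apply]

lemma approx_mem_closure (s : Finset A) (N : ℕ) (b : Finset B) :
    approx t h s N b ∈ AddSubgroup.closure {f | ∃ p : ℕ × B,
      ∃ σ : F p.1 →ₗ[S] TreeModule t h, f = σ ∘ₗ coord t h p.1 p.2} :=
  add_mem (sum_mem fun a _ => AddSubgroup.subset_closure ⟨(N, h a N), _, rfl⟩)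
    (sum_mem fun k _ => sum_mem fun b _ => AddSubgroup.subset_closure ⟨(k, b), _, rfl⟩)

lemma approx_node (s : Finset A) {N n : ℕ} (hn : n < N) {b : Finset B} {b₀ : B} (hb : b₀ ∈ b)
    (x : F n) : approx t h s N b (node t h n b₀ x) = node t h n b₀ x := by
  rw [approx_apply, Finset.sum_eq_zero, zero_add,
    Finset.sum_eq_single_of_mem n (Finset.mem_range.2 hn), Finset.sum_eq_single_of_mem b₀ hb,
    coord_node_self]
  · intro b' _ hne
    rw [coord_node_of_ne t h (fun e => hne (congrArg Prod.snd e).symm), map_zero]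
  · intro k _ hne
    refine Finset.sum_eq_zero fun b' _ => ?_
    rw [coord_node_of_ne t h (fun e => hne (congrArg Prod.fst e).symm), map_zero]
  · intro a _
    rw [coord_node_of_ne t h (fun e => hn.ne (congrArg Prod.fst e)), map_zero]

lemma approx_tail {s : Finset A} {N n : ℕ} (hn : n ≤ N) {b : Finset B} {a : A} (ha : a ∈ s)
    (hs : Set.InjOn (h · N) (s : Set A)) (hb : ∀ k < N, h a k ∈ b) (x : F n) :
    approx t h s N b (tail t h a n x) = tail t h a n x := by
  induction hn using Nat.decreasingInduction with
  | of_succ n hn ih =>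
    rw [tail_eq, map_add, ih, approx_node t h s hn (hb n hn)]
  | self =>
    rw [approx_apply, Finset.sum_eq_single_of_mem a ha, coord_tail t h le_rfl,
      chainTransitionMap_self, Finset.sum_eq_zero, add_zero, LinearMap.id_apply]
    · intro k hk
      refine Finset.sum_eq_zero fun b' _ => ?_
      rw [coord_tail_of_lt t h a (Finset.mem_range.1 hk), map_zero]
    · intro a' ha' hne
      rw [coord_tail_of_ne t h (fun e => hne (hs ha' ha e.symm)), map_zero]

variable {t h}

/-- If distinct branches are eventually separated, then suitable finite approximations of the
identity are eventually equal to it pointwise. -/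
lemma exists_approx (hsep : ∀ a a', a ≠ a' → ∀ᶠ n in Filter.atTop, h a n ≠ h a' n) :
    ∃ Φ : Finset A × ℕ × Finset B → TreeModule t h →ₗ[S] TreeModule t h,
      (∀ i, Φ i ∈ AddSubgroup.closure {f | ∃ p : ℕ × B,
        ∃ σ : F p.1 →ₗ[S] TreeModule t h, f = σ ∘ₗ coord t h p.1 p.2}) ∧
      ∀ z, ∀ᶠ i in Filter.atTop, Φ i z = z := by
  classical
  have hN : ∀ (s : Finset A) (m : ℕ), ∃ N, m < N ∧ Set.InjOn (h · N) (s : Set A) := by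
    intro s m
    have : ∀ᶠ n in Filter.atTop, ∀ a ∈ s, ∀ a' ∈ s, a ≠ a' → h a n ≠ h a' n := by
      simp only [Filter.eventually_all_finset, Filter.eventually_imp_distrib_left]
      exact fun a _ a' _ hne => hsep a a' hne
    obtain ⟨N, hN, hm⟩ := (this.and (Filter.eventually_gt_atTop m)).exists
    exact ⟨N, hm, fun a ha a' ha' e => by_contra fun hne => hN a ha a' ha' hne e⟩
  choose N hmN hN using hN
  refine ⟨fun i => approx t h i.1 (N i.1 i.2.1) (i.2.2 ∪ i.1.biUnion fun a =>
    (Finset.range (N i.1 i.2.1)).image (h a)), fun i => approx_mem_closure t h _ _ _, fun z => ?_⟩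
  induction z using TreeModule.induction_on with
  | h0 => simp
  | htail a n x =>
    filter_upwards [Filter.eventually_ge_atTop (({a}, n, ∅) : Finset A × ℕ × Finset B)]
      with i hi
    have ha : a ∈ i.1 := hi.1 (Finset.mem_singleton_self a)
    refine approx_tail t h (hi.2.1.trans (hmN _ _).le) ha (hN _ _) (fun k hk => ?_) x
    exact Finset.mem_union_right _ (Finset.mem_biUnion.2
      ⟨a, ha, Finset.mem_image_of_mem _ (Finset.mem_range.2 hk)⟩)
  | hnode n b x =>
    filter_upwards [Filter.eventually_ge_atTop ((∅, n, {b}) : Finset A × ℕ × Finset B)]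
      with i hi
    exact approx_node t h _ (lt_of_le_of_lt hi.2.1 (hmN _ _))
      (Finset.mem_union_left _ (hi.2.2 (Finset.mem_singleton_self b))) x
  | hadd x y hx hy =>
    filter_upwards [hx, hy] with i hx hy
    rw [map_add, hx, hy]

end TreeModule

lemma treeRel_injective : Function.Injective (treeRel t h) := by
  classical
  have h0 : ∀ r a, (treeRel t h r).1 (a, 0) = r (a, 0) := by
    intro r a
    induction r using DirectSum.induction_on with
    | zero => simp
    | add x y hx hy => simp only [map_add, Prod.fst_add, DirectSum.add_apply, hx, hy]
    | of i x =>
      obtain ⟨a', m⟩ := i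
      change (treeRel t h (DirectSum.lof S (A × ℕ) (fun p => F p.2) (a', m) x)).1 (a, 0) = _
      rw [treeRel_lof]
      simp [DirectSum.lof_eq_of, DirectSum.of_apply, DirectSum.sub_apply]
  have hsucc : ∀ r a n, (treeRel t h r).1 (a, n + 1) = r (a, n + 1) - t n (r (a, n)) := by
    intro r a n
    induction r using DirectSum.induction_on with
    | zero => simp
    | add x y hx hy =>
      simp only [map_add, Prod.fst_add, DirectSum.add_apply, hx, hy]
      abel
    | of i x =>
      obtain ⟨a', m⟩ := i
      change (treeRel t h (DirectSum.lof S (A × ℕ) (fun p => F p.2) (a', m) x)).1 (a, n + 1) = _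
      rw [treeRel_lof]
      simp only [DirectSum.lof_eq_of, DirectSum.sub_apply]
      congr 1
      by_cases hm : (a', m) = (a, n)
      · obtain ⟨rfl, rfl⟩ := Prod.mk.inj hm
        simp
      · rw [DirectSum.of_eq_of_ne _ _ _ (Ne.symm hm), map_zero]
        exact DirectSum.of_eq_of_ne _ _ _ (fun e => hm (by simpa using e.symm))
  refine (injective_iff_map_eq_zero _).2 fun r hr => DFinsupp.ext fun ⟨a, n⟩ => ?_
  induction n with
  | zero =>
    have := h0 r a
    rw [hr] at this
    exact this.symm
  | succ n ih =>
    have := hsucc r a n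
    rw [hr, show r (a, n) = 0 from ih, map_zero, sub_zero] at this
    exact this.symm

lemma HasExtensionProperty.exists_of_treeModule {C : Type u} [AddCommGroup C] [Module S C]
    (hC : HasExtensionProperty S (TreeModule t h) C) (c : A → ∀ n, F n →ₗ[S] C) :
    ∃ (d : A → ∀ n, F n →ₗ[S] C) (v : B → ∀ n, F n →ₗ[S] C),
      ∀ a n x, c a n x = d a n x - d a (n + 1) (t n x) - v (h a n) n x := by
  classical
  obtain ⟨ψ, hψ⟩ := hC _ _ (treeRel t h) (LinearMap.range (treeRel t h)).mkQ
    (treeRel_injective t h) (Submodule.mkQ_surjective _) (LinearMap.exact_map_mkQ_range _)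
    (DirectSum.toModule S (A × ℕ) C fun p => c p.1 p.2)
  refine ⟨fun a n => ψ ∘ₗ LinearMap.inl S _ _ ∘ₗ DirectSum.lof S (A × ℕ) (fun p => F p.2) (a, n),
    fun b n => ψ ∘ₗ LinearMap.inr S _ _ ∘ₗ DirectSum.lof S (ℕ × B) (fun p => F p.1) (n, b),
    fun a n x => ?_⟩
  have := hψ (DirectSum.lof S (A × ℕ) (fun p => F p.2) (a, n) x)
  rw [DirectSum.toModule_lof, treeRel_lof] at this
  rw [← this]
  simp only [LinearMap.comp_apply, ← map_sub]
  congr 1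
  ext <;> simp

/-- If there are more subsets of the set of branches than families of maps indexed by the nodes,
then the extension property of the tree module solves all `lim¹`-equations for the chain. -/
lemma HasExtensionProperty.lim_of_treeModule {C : Type u} [AddCommGroup C] [Module S C]
    (hC : HasExtensionProperty S (TreeModule t h) C)
    (hcard : ∀ v : Set A → B → ∀ n, F n →ₗ[S] C, ¬ Function.Injective v)
    (c : ∀ n, F n →ₗ[S] C) :
    ∃ d : ∀ n, F n →ₗ[S] C, ∀ n x, c n x = d n x - d (n + 1) (t n x) := by
  classical
  choose d v hdv using fun X : Set A =>
    hC.exists_of_treeModule t h fun a n => if a ∈ X then c n else 0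
  have key : ∀ X Y a, v X = v Y → a ∈ X → a ∉ Y →
      ∃ d : ∀ n, F n →ₗ[S] C, ∀ n x, c n x = d n x - d (n + 1) (t n x) := by
    intro X Y a hv hX hY
    refine ⟨fun n => d X a n - d Y a n, fun n x => ?_⟩
    have h1 := hdv X a n x
    have h2 := hdv Y a n x
    rw [if_pos hX] at h1
    rw [if_neg hY, LinearMap.zero_apply] at h2
    rw [h1, ← sub_zero (_ - _), h2, hv]
    simp only [LinearMap.sub_apply]
    abel
  obtain ⟨X, Y, hv, hne⟩ := Function.not_injective_iff.1 (hcard v)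
  by_cases hXY : X ⊆ Y
  · obtain ⟨a, hY, hX⟩ := Set.not_subset.1 fun hYX => hne (hXY.antisymm hYX)
    exact key Y X a hv.symm hY hX
  · obtain ⟨a, hX, hY⟩ := Set.not_subset.1 hXY
    exact key X Y a hv hX hY

end TreeModule

section EventuallyDifferent

open Cardinal

/-- There are arbitrarily large cardinals `κ` with `2 ^ κ ≤ κ ^ ℵ₀`. -/
lemma Cardinal.exists_two_power_le_power_aleph0 (c : Cardinal.{u}) :
    ∃ κ : Cardinal.{u}, c ≤ κ ∧ ℵ₀ ≤ κ ∧ (2 : Cardinal.{u}) ^ κ ≤ κ ^ ℵ₀ := by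
  let e : ℕ → Cardinal.{u} := fun n => Nat.rec (max c ℵ₀) (fun _ x => 2 ^ x) n
  have he : ∀ n, e n ≤ Cardinal.sum e := fun n => Cardinal.le_sum e n
  refine ⟨Cardinal.sum e, (le_max_left _ _).trans (he 0), (le_max_right _ _).trans (he 0), ?_⟩
  rw [Cardinal.power_sum]
  calc Cardinal.prod (fun n => (2 : Cardinal.{u}) ^ e n)
      ≤ Cardinal.prod (fun _ : ℕ => Cardinal.sum e) := Cardinal.prod_le_prod _ _ fun n => he (n + 1)
    _ = Cardinal.sum e ^ ℵ₀ := by simp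

/-- There is a family `h` of pairwise eventually different sequences such that the index type `A`
has more subsets than there are functions from the type of values to `W`. -/
lemma exists_eventually_different_family (W : Type u) :
    ∃ (A B : Type u) (h : A → ℕ → B),
      (∀ a a', a ≠ a' → ∀ᶠ n in Filter.atTop, h a n ≠ h a' n) ∧
      ∀ v : Set A → B → W, ¬ Function.Injective v := by
  obtain ⟨κ, hW, hκ, hpow⟩ := Cardinal.exists_two_power_le_power_aleph0 #W
  have : Infinite κ.out := Cardinal.infinite_iff.2 (by rwa [Cardinal.mk_out])
  refine ⟨ℕ → κ.out, List κ.out, fun a n => (List.range n).map a, fun a a' hne => ?_,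
    fun v hv => ?_⟩
  · obtain ⟨k, hk⟩ := Function.ne_iff.1 hne
    filter_upwards [Filter.eventually_gt_atTop k] with n hn e
    exact hk (List.map_inj_left.1 e k (List.mem_range.2 hn))
  · have h1 : #(Set (ℕ → κ.out)) ≤ #(List κ.out → W) := Cardinal.mk_le_of_injective hv
    have h2 : #(List κ.out → W) ≤ κ ^ ℵ₀ := by
      rw [← Cardinal.power_def, Cardinal.mk_list_eq_mk, Cardinal.mk_out]
      calc #W ^ κ ≤ κ ^ κ := Cardinal.power_le_power_right hW
        _ = 2 ^ κ := Cardinal.power_self_eq hκ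
        _ ≤ κ ^ ℵ₀ := hpow
    refine absurd (h1.trans h2) (not_le.2 ?_)
    rw [Cardinal.mk_set]
    simpa using Cardinal.cantor (κ ^ ℵ₀)

end EventuallyDifferent
section FlatMittagLeffler

variable {R : Type u} [Ring R] {F : ℕ → Type u} [∀ n, AddCommGroup (F n)]
  [∀ n, Module Rᵐᵒᵖ (F n)] (t : ∀ n, F n →ₗ[Rᵐᵒᵖ] F (n + 1)) {A B : Type u} {h : A → ℕ → B}

namespace TreeModule

lemma eq_zero_of_mapLeft_coord_eq_zero
    (hsep : ∀ a a', a ≠ a' → ∀ᶠ n in Filter.atTop, h a n ≠ h a' n)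
    {Q : Type u} [AddCommGroup Q] [Module R Q] (z : NCTensor R (TreeModule t h) Q)
    (hz : ∀ p : ℕ × B, NCTensor.mapLeft Q (coord t h p.1 p.2) z = 0) : z = 0 := by
  classical
  obtain ⟨Φ, hΦ, hid⟩ := exists_approx (t := t) hsep
  exact NCTensor.eq_zero_of_mapLeft_eq_zero (G := fun p : ℕ × B => F p.1)
    (fun p => coord t h p.1 p.2) (l := Filter.atTop) Φ hΦ hid z hz

lemma isRightFlat (hsep : ∀ a a', a ≠ a' → ∀ᶠ n in Filter.atTop, h a n ≠ h a' n)
    (hflat : ∀ n, IsRightFlat R (F n)) : IsRightFlat R (TreeModule t h) :=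
  IsRightFlat.of_jointly_injective (G := fun p : ℕ × B => F p.1) (fun p => coord t h p.1 p.2)
    (fun _ _ _ z hz => eq_zero_of_mapLeft_coord_eq_zero t hsep z hz) fun p => hflat p.1

lemma isMittagLeffler (hsep : ∀ a a', a ≠ a' → ∀ᶠ n in Filter.atTop, h a n ≠ h a' n)
    (hml : ∀ n, IsMittagLeffler R (F n)) : IsMittagLeffler R (TreeModule t h) :=
  IsMittagLeffler.of_jointly_injective (G := fun p : ℕ × B => F p.1) (fun p => coord t h p.1 p.2)
    (fun _ _ _ z hz => eq_zero_of_mapLeft_coord_eq_zero t hsep z hz) fun p => hml p.1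

end TreeModule

end FlatMittagLeffler

/-- Over any ring `R`, the direct limit of a countable chain
`F 0 → F 1 → F 2 → ⋯` of flat Mittag-Leffler right `R`-modules belongs to the double
Ext-orthogonal class `^⊥(𝒟^⊥)` of the class `𝒟` of flat Mittag-Leffler right `R`-modules:
for every right `R`-module `C` satisfying `Ext¹(D, C) = 0` for all `D ∈ 𝒟`, one has
`Ext¹(colim Fₙ, C) = 0`. -/
theorem chainDirectLimit_mem_double_perp_of_flat_mittagLeffler
    (R : Type u) [Ring R] (F : ℕ → Type u)
    [∀ n, AddCommGroup (F n)] [∀ n, Module Rᵐᵒᵖ (F n)]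
    (t : ∀ n, F n →ₗ[Rᵐᵒᵖ] F (n + 1))
    (hflat : ∀ n, IsRightFlat R (F n)) (hml : ∀ n, IsMittagLeffler R (F n))
    (C : ModuleCat.{u} Rᵐᵒᵖ)
    (hC : ∀ D : ModuleCat.{u} Rᵐᵒᵖ, IsRightFlat R D → IsMittagLeffler R D →
      Subsingleton (ext1 R D C)) :
    Subsingleton (ext1 R (ModuleCat.of Rᵐᵒᵖ (chainDirectLimit F t)) C) := by
  have hext : ∀ (D : Type u) [AddCommGroup D] [Module Rᵐᵒᵖ D], IsRightFlat R D →
      IsMittagLeffler R D → HasExtensionProperty Rᵐᵒᵖ D C := fun D _ _ h1 h2 =>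
    (subsingleton_ext1_iff_hasExtensionProperty (ModuleCat.of Rᵐᵒᵖ D) C).1 (hC _ h1 h2)
  obtain ⟨A, B, h, hsep, hcard⟩ := exists_eventually_different_family (∀ n, F n →ₗ[Rᵐᵒᵖ] C)
  have htree : HasExtensionProperty Rᵐᵒᵖ (TreeModule t h) C :=
    hext _ (TreeModule.isRightFlat t hsep hflat) (TreeModule.isMittagLeffler t hsep hml)
  rw [subsingleton_ext1_iff_hasExtensionProperty]
  exact HasExtensionProperty.chainDirectLimit t (fun n => hext _ (hflat n) (hml n))
    (htree.lim_of_treeModule t h hcard)
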